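/- arXiv:alg-geom/9402005 — 2 statements merged into one kernel-verified Lean document; each statement's English description precedes it below -/
import Mathlib

section
/- Let k ≥ 2, n ≥ 1, and let ξ ∈ S_{k−2} ⊗ S_{k−2} ⊗ V_{n−1} ⊗ V_{n−1} be a nonzero element with Φ^∨(ξ) = 0. If the lexicographically smallest index tuple at which ξ has a nonzero coordinate has the form (α, β, μ, ν̄) with the third index unbarred and the fourth barred, then μ ≠ 0 and ν ≠ 0. -/
open scoped TensorProduct
open MvPolynomial

noncomputable section

set_option maxHeartbeats 1000000
set_option synthInstance.maxHeartbeats 1000000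

variable (K : Type) [Field K] [CharZero K]

set_option linter.unusedSectionVars false

/-- `S K m` is the space of homogeneous polynomials of degree `m` in the two variables
`s = X 0` and `t = X 1`, with the convention `S K m = 0` for `m < 0`. -/
def S (m : ℤ) : Submodule K (MvPolynomial (Fin 2) K) :=
  if 0 ≤ m then homogeneousSubmodule (Fin 2) K m.toNat else ⊥

/-- The basis vector `s` of `U = S K 1`. -/
def sU : S K 1 := ⟨X 0, by
  simp only [S, if_pos (by norm_num : (0:ℤ) ≤ 1), Int.toNat_one, mem_homogeneousSubmodule]
  exact isHomogeneous_X _ _⟩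

/-- The basis vector `t` of `U = S K 1`. -/
def tU : S K 1 := ⟨X 1, by
  simp only [S, if_pos (by norm_num : (0:ℤ) ≤ 1), Int.toNat_one, mem_homogeneousSubmodule]
  exact isHomogeneous_X _ _⟩

lemma mul_mem_S {a b c : ℤ} (h : c = a + b) {p q : MvPolynomial (Fin 2) K}
    (hp : p ∈ S K a) (hq : q ∈ S K b) : p * q ∈ S K c := by
  by_cases ha : 0 ≤ a
  · by_cases hb : 0 ≤ b
    · have hc : 0 ≤ c := by omega
      simp only [S, if_pos ha, if_pos hb, if_pos hc, mem_homogeneousSubmodule] at *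
      have e : c.toNat = a.toNat + b.toNat := by omega
      exact e ▸ hp.mul hq
    · simp only [S, if_neg hb, Submodule.mem_bot] at hq
      subst hq
      simp
  · simp only [S, if_neg ha, Submodule.mem_bot] at hp
    subst hp
    simp

/-- Multiplication of homogeneous polynomials, `S K a × S K b → S K c` whenever `c = a + b`. -/
def mulP {a b c : ℤ} (h : c = a + b) (f : S K a) (g : S K b) : S K c :=
  ⟨(f : MvPolynomial (Fin 2) K) * g, mul_mem_S K h f.2 g.2⟩

/-- Multiplication by a linear form `u ∈ U = S K 1`, as a linear map `S K b →ₗ S K c`,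
where `c = 1 + b`. -/
def mulLin {b c : ℤ} (h : c = 1 + b) (u : S K 1) : S K b →ₗ[K] S K c where
  toFun f := mulP K h u f
  map_add' f g := Subtype.ext (by simp [mulP, mul_add])
  map_smul' r f := Subtype.ext (by simp [mulP, mul_smul_comm])

/-- `V K m = U ⊗ S K m` where `U = S K 1`; it is `0` for `m < 0`. -/
abbrev V (m : ℤ) := (S K 1) ⊗[K] (S K m)

/-- Multiplication by the linear form `u ∈ U` on `V K b`: `u • (w ⊗ h) = w ⊗ (u*h)`. -/
def VMul {b c : ℤ} (h : c = 1 + b) (u : S K 1) : V K b →ₗ[K] V K c :=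
  LinearMap.lTensor (S K 1) (mulLin K h u)

section InstanceShortcuts

/-! Shortcut instances: Lean's instance search is very slow on iterated tensor products of
submodule coercions, so we register the instances for the shapes used below explicitly. -/

set_option synthInstance.maxHeartbeats 1000000

noncomputable instance iAG2 (a b : ℤ) : AddCommGroup ((S K a) ⊗[K] (S K b)) := by
  exact TensorProduct.addCommGroup

noncomputable instance iAG3 (a b c : ℤ) :
    AddCommGroup ((S K a) ⊗[K] ((S K b) ⊗[K] (S K c))) := by
  exact TensorProduct.addCommGroup

noncomputable instance iAG4 (a b c d : ℤ) :
    AddCommGroup (((S K a) ⊗[K] (S K b)) ⊗[K] ((S K c) ⊗[K] (S K d))) := by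
  exact TensorProduct.addCommGroup

noncomputable instance iAG5 (a b c d e : ℤ) :
    AddCommGroup ((S K a) ⊗[K] (((S K b) ⊗[K] (S K c)) ⊗[K] ((S K d) ⊗[K] (S K e)))) := by
  exact TensorProduct.addCommGroup

noncomputable instance iAG6 (a b c d e f : ℤ) :
    AddCommGroup ((S K a) ⊗[K]
      ((S K b) ⊗[K] (((S K c) ⊗[K] (S K d)) ⊗[K] ((S K e) ⊗[K] (S K f))))) := by
  exact TensorProduct.addCommGroup

noncomputable instance iAGW (m : ℤ) : AddCommGroup ↥(⋀[K]^2 (V K m)) := by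
  exact Submodule.addCommGroup _

noncomputable instance iAGSW (a m : ℤ) : AddCommGroup ((S K a) ⊗[K] ↥(⋀[K]^2 (V K m))) := by
  exact TensorProduct.addCommGroup

noncomputable instance iAGSSW (a b m : ℤ) :
    AddCommGroup ((S K a) ⊗[K] ((S K b) ⊗[K] ↥(⋀[K]^2 (V K m)))) := by
  exact TensorProduct.addCommGroup

end InstanceShortcuts

/-- The wedge `v ∧ w` of two elements of `V K m`, in the exterior square `⋀[K]^2 (V K m)`. -/
def wedge {m : ℤ} (v w : V K m) : ⋀[K]^2 (V K m) :=
  ⟨ExteriorAlgebra.ιMulti K 2 ![v, w], ExteriorAlgebra.ιMulti_range K 2 (Set.mem_range_self _)⟩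

/-- The coordinate functional on `S K m` w.r.t. the basis vector `s^(m-α) * t^α`
(the zero functional for out-of-range indices). -/
def coeffS (m : ℤ) (α : ℤ) : S K m →ₗ[K] K :=
  if 0 ≤ α ∧ α ≤ m then
    (lcoeff K (Finsupp.single (0 : Fin 2) (m - α).toNat + Finsupp.single (1 : Fin 2) α.toNat)) ∘ₗ
      (S K m).subtype
  else 0

/-- The tensor product of two linear functionals, as a functional on the tensor product. -/
def tmulFun {M N : Type} [AddCommGroup M] [Module K M] [AddCommGroup N] [Module K N]
    (φ : M →ₗ[K] K) (ψ : N →ₗ[K] K) : M ⊗[K] N →ₗ[K] K :=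
  (TensorProduct.lid K K).toLinearMap ∘ₗ TensorProduct.map φ ψ

/-- An index for the basis of `V K m`: `(false, μ)` stands for the unbarred basis vector
`x_μ = s ⊗ s^(m-μ)t^μ` and `(true, μ)` for the barred basis vector `x̄_μ = t ⊗ s^(m-μ)t^μ`. -/
abbrev VIdx := Bool × ℤ

/-- The coordinate functional on `V K m` at the basis vector indexed by `ι : VIdx`. -/
def coeffV (m : ℤ) (ι : VIdx) : V K m →ₗ[K] K :=
  tmulFun K (coeffS K 1 (if ι.1 then 1 else 0)) (coeffS K m ι.2)

/-- The alternating bilinear form `(v, w) ↦ φ(v)ψ(w) - φ(w)ψ(v)` built from two functionals. -/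
def altForm {M : Type} [AddCommGroup M] [Module K M] (φ ψ : M →ₗ[K] K) :
    M [⋀^Fin 2]→ₗ[K] K :=
  MultilinearMap.alternatization
    ((MultilinearMap.mkPiAlgebra K (Fin 2) K).compLinearMap ![φ, ψ])

/-- The functional on `⋀[K]^2 M` induced by the alternating form `altForm φ ψ`.  For
dual-basis functionals `φ`, `ψ` of two basis vectors `e`, `f` of `M` this is the coordinate
functional at the basis vector `e ∧ f` of the exterior square. -/
def coLam {M : Type} [AddCommGroup M] [Module K M] (φ ψ : M →ₗ[K] K) :
    ⋀[K]^2 M →ₗ[K] K :=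
  (ExteriorAlgebra.liftAlternating
    (fun i => match i with | 2 => altForm K φ ψ | _ => 0)) ∘ₗ (⋀[K]^2 M).subtype

/-- The determinant form on `U = S K 1` normalized by `d(s,t) = 1`. -/
def detU (w w' : S K 1) : K :=
  coeffS K 1 0 w * coeffS K 1 1 w' - coeffS K 1 1 w * coeffS K 1 0 w'

/-- The domain `S_{k-2} ⊗ S_{k-2} ⊗ V_{n-1} ⊗ V_{n-1}` of the map `Φ^∨`. -/
abbrev PhiDom (k n : ℤ) :=
  (S K (k-2)) ⊗[K] ((S K (k-2)) ⊗[K] (V K (n-1) ⊗[K] V K (n-1)))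

/-- The codomain `S_{k-1} ⊗ S_{k-1} ⊗ Λ²V_n` of the map `Φ^∨`. -/
abbrev PhiCod (k n : ℤ) :=
  (S K (k-1)) ⊗[K] ((S K (k-1)) ⊗[K] ↥(⋀[K]^2 (V K n)))

/-- The domain `S_{k-3} ⊗ S_{k-3} ⊗ V_{n-2} ⊗ V_{n-2}` of the map `ε'`. -/
abbrev EpsDom (k n : ℤ) :=
  (S K (k-3)) ⊗[K] ((S K (k-3)) ⊗[K] (V K (n-2) ⊗[K] V K (n-2)))

/-- `Φ` is the map `Φ^∨` of the paper:
`Φ^∨(g ⊗ g' ⊗ v ⊗ v') = sg ⊗ sg' ⊗ (tv ∧ tv') − sg ⊗ tg' ⊗ (tv ∧ sv')`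
`− tg ⊗ sg' ⊗ (sv ∧ tv') + tg ⊗ tg' ⊗ (sv ∧ sv')`. -/
def IsPhi (k n : ℤ) (Φ : PhiDom K k n →ₗ[K] PhiCod K k n) : Prop :=
  let sk : S K (k-2) → S K (k-1) := mulP K (by ring) (sU K)
  let tk : S K (k-2) → S K (k-1) := mulP K (by ring) (tU K)
  let sn : V K (n-1) →ₗ[K] V K n := VMul K (by ring) (sU K)
  let tn : V K (n-1) →ₗ[K] V K n := VMul K (by ring) (tU K)
  ∀ (g g' : S K (k-2)) (v v' : V K (n-1)),
    Φ (g ⊗ₜ[K] (g' ⊗ₜ[K] (v ⊗ₜ[K] v'))) =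
        (sk g) ⊗ₜ[K] ((sk g') ⊗ₜ[K] (wedge K (tn v) (tn v')))
      - (sk g) ⊗ₜ[K] ((tk g') ⊗ₜ[K] (wedge K (tn v) (sn v')))
      - (tk g) ⊗ₜ[K] ((sk g') ⊗ₜ[K] (wedge K (sn v) (tn v')))
      + (tk g) ⊗ₜ[K] ((tk g') ⊗ₜ[K] (wedge K (sn v) (sn v')))

/-- `ε` is the map `ε'` of the paper:
`ε'(f ⊗ f' ⊗ u ⊗ u') = sf ⊗ sf' ⊗ tu ⊗ tu' − sf ⊗ tf' ⊗ su ⊗ tu'`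
`− tf ⊗ sf' ⊗ tu ⊗ su' + tf ⊗ tf' ⊗ su ⊗ su'`. -/
def IsEps (k n : ℤ) (ε : EpsDom K k n →ₗ[K] PhiDom K k n) : Prop :=
  let sk : S K (k-3) → S K (k-2) := mulP K (by ring) (sU K)
  let tk : S K (k-3) → S K (k-2) := mulP K (by ring) (tU K)
  let sn : V K (n-2) →ₗ[K] V K (n-1) := VMul K (by ring) (sU K)
  let tn : V K (n-2) →ₗ[K] V K (n-1) := VMul K (by ring) (tU K)
  ∀ (f f' : S K (k-3)) (u u' : V K (n-2)),
    ε (f ⊗ₜ[K] (f' ⊗ₜ[K] (u ⊗ₜ[K] u'))) =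
        (sk f) ⊗ₜ[K] ((sk f') ⊗ₜ[K] ((tn u) ⊗ₜ[K] (tn u')))
      - (sk f) ⊗ₜ[K] ((tk f') ⊗ₜ[K] ((sn u) ⊗ₜ[K] (tn u')))
      - (tk f) ⊗ₜ[K] ((sk f') ⊗ₜ[K] ((tn u) ⊗ₜ[K] (sn u')))
      + (tk f) ⊗ₜ[K] ((tk f') ⊗ₜ[K] ((sn u) ⊗ₜ[K] (sn u')))

/-- The coordinate `c(α, β, ι, κ)` of an element `ξ` of `S_{k-2} ⊗ S_{k-2} ⊗ V_{n-1} ⊗ V_{n-1}`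
at the basis vector `f_α ⊗ f_β ⊗ z_ι ⊗ z_κ`; it is `0` for out-of-range indices. -/
def cCoord (k n : ℤ) (ξ : PhiDom K k n) (α β : ℤ) (ι κ : VIdx) : K :=
  tmulFun K (coeffS K (k-2) α)
    (tmulFun K (coeffS K (k-2) β)
      (tmulFun K (coeffV K (n-1) ι) (coeffV K (n-1) κ))) ξ

/-- The coordinate of an element `η` of `S_{k-1} ⊗ S_{k-1} ⊗ Λ²V_n` at the basis vector
`g_α ⊗ g_β ⊗ (z_ι ∧ z_κ)` of the codomain of `Φ^∨`. -/
def dCoord (k n : ℤ) (η : PhiCod K k n) (α β : ℤ) (ι κ : VIdx) : K :=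
  tmulFun K (coeffS K (k-1) α)
    (tmulFun K (coeffS K (k-1) β)
      (coLam K (coeffV K n ι) (coeffV K n κ))) η

/-- Index tuples `(α, β, ι, κ)` for the coordinates of elements of
`S_{k-2} ⊗ S_{k-2} ⊗ V_{n-1} ⊗ V_{n-1}`. -/
abbrev Idx := ℤ × ℤ × VIdx × VIdx

/-- The order on `V`-indices: unbarred indices are compared among themselves by size, barred
indices among themselves by size, and every unbarred index precedes every barred index. -/
def vIdxLt : VIdx → VIdx → Prop := Prod.Lex (· < ·) (· < ·)

/-- The lexicographical order on index tuples. -/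
def idxLt : Idx → Idx → Prop :=
  Prod.Lex (· < ·) (Prod.Lex (· < ·) (Prod.Lex (vIdxLt) (vIdxLt)))

/-- `t` is the lexicographically smallest index tuple at which `ξ` has a nonzero coordinate. -/
def IsFirstNonzero (k n : ℤ) (ξ : PhiDom K k n) (t : Idx) : Prop :=
  cCoord K k n ξ t.1 t.2.1 t.2.2.1 t.2.2.2 ≠ 0 ∧
  ∀ t' : Idx, idxLt t' t → cCoord K k n ξ t'.1 t'.2.1 t'.2.2.1 t'.2.2.2 = 0

lemma coeffS_s {b c : ℤ} (h : c = 1 + b) (g : S K b) (a : ℤ) :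
    coeffS K c a (mulP K h (sU K) g) = coeffS K b a g := by
  by_cases hb : 0 ≤ a ∧ a ≤ b
  · rw [coeffS, coeffS, if_pos hb, if_pos ⟨hb.1, by omega⟩]
    have e : (c - a).toNat = (b - a).toNat + 1 := by omega
    simp only [LinearMap.comp_apply, Submodule.subtype_apply, lcoeff_apply, mulP, sU, e]
    rw [Finsupp.single_add, add_comm (Finsupp.single (0 : Fin 2) (b - a).toNat), add_assoc,
      coeff_X_mul]
  · rw [show coeffS K b a = 0 by rw [coeffS, if_neg hb]]
    by_cases hc : 0 ≤ a ∧ a ≤ c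
    · rw [coeffS, if_pos hc]
      have e : (c - a).toNat = 0 := by omega
      simp only [LinearMap.comp_apply, Submodule.subtype_apply, lcoeff_apply, mulP, sU, e]
      rw [coeff_X_mul']
      simp
    · rw [coeffS, if_neg hc]; rfl

lemma coeffS_t {b c : ℤ} (h : c = 1 + b) (g : S K b) (a : ℤ) :
    coeffS K c a (mulP K h (tU K) g) = coeffS K b (a - 1) g := by
  by_cases hb : 0 ≤ a - 1 ∧ a - 1 ≤ b
  · rw [coeffS, coeffS, if_pos hb, if_pos ⟨by omega, by omega⟩]
    have e : (c - a).toNat = (b - (a - 1)).toNat := by omega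
    have e' : a.toNat = (a - 1).toNat + 1 := by omega
    simp only [LinearMap.comp_apply, Submodule.subtype_apply, lcoeff_apply, mulP, tU, e, e']
    rw [Finsupp.single_add, ← add_assoc, add_comm _ (Finsupp.single (1 : Fin 2) 1), coeff_X_mul]
  · rw [show coeffS K b (a - 1) = 0 by rw [coeffS, if_neg hb]]
    by_cases hc : 0 ≤ a ∧ a ≤ c
    · rw [coeffS, if_pos hc]
      have e : a.toNat = 0 := by omega
      simp only [LinearMap.comp_apply, Submodule.subtype_apply, lcoeff_apply, mulP, tU, e]
      rw [coeff_X_mul']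
      simp
    · rw [coeffS, if_neg hc]; rfl

lemma tmulFun_tmul {M N : Type} [AddCommGroup M] [Module K M] [AddCommGroup N] [Module K N]
    (φ : M →ₗ[K] K) (ψ : N →ₗ[K] K) (m : M) (n : N) :
    tmulFun K φ ψ (m ⊗ₜ[K] n) = φ m * ψ n := by
  simp [tmulFun]

lemma coeffV_s {b c : ℤ} (h : c = 1 + b) (v : V K b) (p : Bool) (i : ℤ) :
    coeffV K c (p, i) (VMul K h (sU K) v) = coeffV K b (p, i) v := by
  induction v using TensorProduct.induction_on with
  | zero => simp only [map_zero]
  | add x y hx hy => simp only [map_add, hx, hy]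
  | tmul w g =>
    rw [VMul, LinearMap.lTensor_tmul, coeffV, coeffV, tmulFun_tmul, tmulFun_tmul]
    exact congrArg _ (coeffS_s K h g i)

lemma coeffV_t {b c : ℤ} (h : c = 1 + b) (v : V K b) (p : Bool) (i : ℤ) :
    coeffV K c (p, i) (VMul K h (tU K) v) = coeffV K b (p, i - 1) v := by
  induction v using TensorProduct.induction_on with
  | zero => simp only [map_zero]
  | add x y hx hy => simp only [map_add, hx, hy]
  | tmul w g =>
    rw [VMul, LinearMap.lTensor_tmul, coeffV, coeffV, tmulFun_tmul, tmulFun_tmul]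
    exact congrArg _ (coeffS_t K h g i)

lemma coLam_wedge {m : ℤ} (φ ψ : V K m →ₗ[K] K) (v w : V K m) :
    coLam K φ ψ (wedge K v w) = φ v * ψ w - φ w * ψ v := by
  rw [coLam, wedge, LinearMap.comp_apply, Submodule.subtype_apply,
    ExteriorAlgebra.liftAlternating_apply_ιMulti]
  have hu : (Finset.univ : Finset (Equiv.Perm (Fin 2))) = {1, Equiv.swap 0 1} := by decide
  have h01 : (1 : Equiv.Perm (Fin 2)) ∉ ({Equiv.swap 0 1} : Finset (Equiv.Perm (Fin 2))) := by
    decide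
  simp [altForm, MultilinearMap.alternatization_apply, Fin.prod_univ_two, hu,
    Finset.sum_insert h01, sub_eq_add_neg]

lemma ext4 {M N P Q : Type} [AddCommGroup M] [Module K M] [AddCommGroup N] [Module K N]
    [AddCommGroup P] [Module K P] [AddCommGroup Q] [Module K Q]
    (f g : M ⊗[K] (N ⊗[K] (P ⊗[K] Q)) →ₗ[K] K)
    (h : ∀ m n p q, f (m ⊗ₜ[K] (n ⊗ₜ[K] (p ⊗ₜ[K] q))) = g (m ⊗ₜ[K] (n ⊗ₜ[K] (p ⊗ₜ[K] q)))) :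
    f = g := by
  ext m n p q
  exact h m n p q

/-- the functional cCoord -/
def cL (k n : ℤ) (α β : ℤ) (ι κ : VIdx) : PhiDom K k n →ₗ[K] K :=
  tmulFun K (coeffS K (k-2) α)
    (tmulFun K (coeffS K (k-2) β)
      (tmulFun K (coeffV K (n-1) ι) (coeffV K (n-1) κ)))

/-- the functional dCoord -/
def dL (k n : ℤ) (α β : ℤ) (ι κ : VIdx) : PhiCod K k n →ₗ[K] K :=
  tmulFun K (coeffS K (k-1) α)
    (tmulFun K (coeffS K (k-1) β)
      (coLam K (coeffV K n ι) (coeffV K n κ)))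

lemma cL_tmul (k n : ℤ) (α β : ℤ) (ι κ : VIdx) (g g' : S K (k-2)) (v v' : V K (n-1)) :
    cL K k n α β ι κ (g ⊗ₜ[K] (g' ⊗ₜ[K] (v ⊗ₜ[K] v'))) =
      coeffS K (k-2) α g * (coeffS K (k-2) β g' * (coeffV K (n-1) ι v * coeffV K (n-1) κ v')) := by
  rw [cL, tmulFun_tmul, tmulFun_tmul, tmulFun_tmul]

lemma dL_tmul (k n : ℤ) (α β : ℤ) (ι κ : VIdx) (g g' : S K (k-1)) (v v' : V K n) :
    dL K k n α β ι κ (g ⊗ₜ[K] (g' ⊗ₜ[K] (wedge K v v'))) =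
      coeffS K (k-1) α g * (coeffS K (k-1) β g' *
        (coeffV K n ι v * coeffV K n κ v' - coeffV K n ι v' * coeffV K n κ v)) := by
  rw [dL, tmulFun_tmul, tmulFun_tmul, coLam_wedge]

lemma key (k n : ℤ) (Φ : PhiDom K k n →ₗ[K] PhiCod K k n) (hΦ : IsPhi K k n Φ)
    (a b i j : ℤ) (p q : Bool) :
    dL K k n a b (p, i) (q, j) ∘ₗ Φ =
      (cL K k n a b (p, i-1) (q, j-1) - cL K k n a (b-1) (p, i-1) (q, j)
        - cL K k n (a-1) b (p, i) (q, j-1) + cL K k n (a-1) (b-1) (p, i) (q, j))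
      - (cL K k n a b (q, j-1) (p, i-1) - cL K k n a (b-1) (q, j-1) (p, i)
        - cL K k n (a-1) b (q, j) (p, i-1) + cL K k n (a-1) (b-1) (q, j) (p, i)) := by
  apply ext4
  intro g g' v v'
  rw [LinearMap.comp_apply, hΦ g g' v v']
  simp only [map_add, map_sub, LinearMap.add_apply, LinearMap.sub_apply, dL_tmul, cL_tmul,
    coeffS_s, coeffS_t, coeffV_s, coeffV_t]
  ring

lemma coeffS_out (m a : ℤ) (h : a < 0) : coeffS K m a = 0 := by
  rw [coeffS, if_neg (by omega)]

lemma coeffV_out (m a : ℤ) (p : Bool) (h : a < 0) : coeffV K m (p, a) = 0 := by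
  rw [coeffV, coeffS_out K m a h]; simp [tmulFun]

lemma cL_out3 (k n a b i : ℤ) (p : Bool) (κ : VIdx) (h : i < 0) :
    cL K k n a b (p, i) κ = 0 := by
  apply ext4; intro g g' v v'
  rw [cL_tmul, coeffV_out K _ _ _ h]; simp

lemma cL_out4 (k n a b i : ℤ) (p : Bool) (κ : VIdx) (h : i < 0) :
    cL K k n a b κ (p, i) = 0 := by
  apply ext4; intro g g' v v'
  rw [cL_tmul, coeffV_out K _ _ _ h]; simp

theorem statement10 (K : Type) [Field K] [CharZero K] (k n : ℤ) (hk : 2 ≤ k) (hn : 1 ≤ n)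
    (ξ : PhiDom K k n) (hξ : ξ ≠ 0)
    (Φ : PhiDom K k n →ₗ[K] PhiCod K k n) (hΦ : IsPhi K k n Φ) (hker : Φ ξ = 0)
    (α β μ ν : ℤ)
    (hfirst : IsFirstNonzero K k n ξ (α, β, (false, μ), (true, ν))) :
    μ ≠ 0 ∧ ν ≠ 0 := by
  obtain ⟨hne, hlt⟩ := hfirst
  change cL K k n α β (false, μ) (true, ν) ξ ≠ 0 at hne
  have h1 : ∀ b ι κ, cL K k n (α - 1) b ι κ ξ = 0 := fun b ι κ =>
    hlt (α - 1, b, ι, κ) (Prod.Lex.left _ _ (by omega))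
  have h2 : ∀ ι κ, cL K k n α (β - 1) ι κ ξ = 0 := fun ι κ =>
    hlt (α, β - 1, ι, κ) (Prod.Lex.right _ (Prod.Lex.left _ _ (by omega)))
  have e1 := fun i j => LinearMap.congr_fun (key K k n Φ hΦ α β i j false true) ξ
  have e2 := fun i j => LinearMap.congr_fun (key K k n Φ hΦ α (β + 1) i j false true) ξ
  simp only [LinearMap.comp_apply, hker, map_zero, LinearMap.add_apply, LinearMap.sub_apply,
    h1, h2, add_sub_cancel_right, sub_zero, add_zero] at e1 e2
  have e1' := e1 (μ + 1) (ν + 1)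
  simp only [add_sub_cancel_right] at e1'
  constructor
  · rintro rfl
    have e := e2 0 (ν + 1)
    rw [cL_out3 K k n _ _ _ _ _ (by omega : (0:ℤ) - 1 < 0),
      cL_out3 K k n _ _ _ _ _ (by omega : (0:ℤ) - 1 < 0),
      cL_out4 K k n _ _ _ _ _ (by omega : (0:ℤ) - 1 < 0)] at e
    simp only [add_sub_cancel_right, LinearMap.zero_apply, sub_zero, zero_sub, neg_neg] at e
    apply hne
    rw [← e, sub_zero] at e1'
    exact e1'.symm
  · rintro rfl
    have e := e2 (μ + 1) 0
    rw [cL_out4 K k n _ _ _ _ _ (by omega : (0:ℤ) - 1 < 0),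
      cL_out3 K k n _ _ _ _ _ (by omega : (0:ℤ) - 1 < 0),
      cL_out3 K k n _ _ _ _ _ (by omega : (0:ℤ) - 1 < 0)] at e
    simp only [add_sub_cancel_right, LinearMap.zero_apply, sub_zero, zero_sub] at e
    apply hne
    exact neg_eq_zero.mp e.symm
end
end

section
/- Let K be an algebraically closed field of characteristic 0. For all integers n ≥ 1 and k ≥ 1 there exists a k-dimensional K-subspace A of the space S_{2n+k−1} of homogeneous polynomials of degree 2n+k−1 in two variables such that no nonzero element of A can be written as a K-linear combination of at most n polynomials of the form ℓ^{2n+k−1}, where ℓ is a linear form. (Equivalently, the projectivization of A does not meet the variety of (n−1)-dimensional secant planes of the rational normal curve of degree 2n+k−1.) -/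
open scoped TensorProduct
open MvPolynomial

noncomputable section

set_option maxHeartbeats 1000000
set_option synthInstance.maxHeartbeats 1000000

variable (K : Type) [Field K] [CharZero K]

set_option linter.unusedSectionVars false

/-- The exponent vector of `s^(D-j) t^j`. -/
def expo (D j : ℕ) : Fin 2 →₀ ℕ :=
  Finsupp.single (0 : Fin 2) (D - j) + Finsupp.single (1 : Fin 2) j

lemma expo_inj {D i j : ℕ} (h : expo D i = expo D j) : i = j := by
  have := DFunLike.congr_fun h 1
  simpa [expo] using this

lemma expo_of_degree {D : ℕ} (e : Fin 2 →₀ ℕ) (h : e.degree = D) : e = expo D (e 1) := by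
  have h2 : e 0 + e 1 = D := by
    rw [← h, Finsupp.degree_eq_sum]; simp
  ext i
  fin_cases i
  · simp [expo]; omega
  · simp [expo]

lemma linear_form_eq {K : Type} [Field K] {p : MvPolynomial (Fin 2) K}
    (hp : p.IsHomogeneous 1) :
    p = C (coeff (expo 1 0) p) * X 0 + C (coeff (expo 1 1) p) * X 1 := by
  ext e
  by_cases he : e.degree = 1
  · have h2 : e 0 + e 1 = 1 := by
      have h := he
      rw [Finsupp.degree_eq_sum] at h
      simpa using h
    have h3 := expo_of_degree e he
    have : e 1 = 0 ∨ e 1 = 1 := by omega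
    rcases this with h | h <;> rw [h] at h3 <;> subst h3 <;>
      simp [coeff_C_mul, coeff_X, expo, Finsupp.single_left_inj]
  · rw [hp.coeff_eq_zero he]
    symm
    have hh : (C (coeff (expo 1 0) p) * X 0 + C (coeff (expo 1 1) p) * X 1 :
        MvPolynomial (Fin 2) K).IsHomogeneous 1 := by
      refine IsHomogeneous.add ?_ ?_
      · simpa using (isHomogeneous_C (Fin 2) (coeff (expo 1 0) p)).mul
          (isHomogeneous_X K (0 : Fin 2))
      · simpa using (isHomogeneous_C (Fin 2) (coeff (expo 1 1) p)).mul
          (isHomogeneous_X K (1 : Fin 2))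
    exact hh.coeff_eq_zero he

lemma coeff_linear_pow {K : Type} [Field K] (a b : K) (D j : ℕ) (hj : j ≤ D) :
    coeff (expo D j) ((C a * X 0 + C b * X 1 : MvPolynomial (Fin 2) K) ^ D)
      = (D.choose j : K) * (a ^ (D - j) * b ^ j) := by
  have key : ∀ i : ℕ, (C b * X 1 : MvPolynomial (Fin 2) K) ^ i * (C a * X 0) ^ (D - i) *
      (D.choose i : MvPolynomial (Fin 2) K) =
      monomial (expo D i) ((D.choose i : K) * (a ^ (D - i) * b ^ i)) := by
    intro i
    have : (D.choose i : MvPolynomial (Fin 2) K) = C (D.choose i : K) := by simp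
    rw [this, mul_pow, mul_pow, X_pow_eq_monomial, X_pow_eq_monomial, ← C_pow, ← C_pow,
      C_mul_monomial, C_mul_monomial, monomial_mul, mul_comm, C_mul_monomial, expo, add_comm]
    congr 1
    ring
  rw [add_comm, add_pow, Finset.sum_congr rfl (fun i _ => key i), coeff_sum,
    Finset.sum_eq_single j]
  · simp
  · intro i _ hij
    rw [coeff_monomial, if_neg]
    exact fun h => hij (expo_inj h)
  · intro h
    exact absurd (Finset.mem_range.2 (by omega)) h

/-- Hankel argument: a sequence `a_j = ∑ c_i α_i^(D-j) β_i^j` (`j ≤ D`, `D = 2N+k-1`) with at most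
`N` terms which vanishes outside the middle window `[N, N+k-1]` vanishes identically. -/
lemma hankel {K : Type} [Field K] (N k D : ℕ) (hD : D + 1 = 2 * N + k)
    (c α β : Fin N → K)
    (h0 : ∀ j, j ≤ D → (j < N ∨ N + k ≤ j) → ∑ i, c i * (α i ^ (D - j) * β i ^ j) = 0) :
    ∀ j, j ≤ D → ∑ i, c i * (α i ^ (D - j) * β i ^ j) = 0 := by
  classical
  let L : (Fin (N + 1) → K) →ₗ[K] (Fin N → K) :=
    Matrix.mulVecLin (Matrix.of fun (i : Fin N) (r : Fin (N + 1)) =>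
      α i ^ (N - (r : ℕ)) * β i ^ (r : ℕ))
  have hker : LinearMap.ker L ≠ ⊥ := LinearMap.ker_ne_bot_of_finrank_lt (by simp)
  obtain ⟨q, hq, hq0⟩ := (Submodule.ne_bot_iff _).1 hker
  have hq' : ∀ i, ∑ r : Fin (N + 1), α i ^ (N - (r : ℕ)) * β i ^ (r : ℕ) * q r = 0 := by
    intro i
    have := congrFun (LinearMap.mem_ker.1 hq) i
    simpa [L, Matrix.mulVec, dotProduct] using this
  have hrel : ∀ j, j + N ≤ D →
      ∑ r : Fin (N + 1), q r * ∑ i, c i * (α i ^ (D - (j + r)) * β i ^ (j + (r : ℕ))) = 0 := by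
    intro j hj
    simp_rw [Finset.mul_sum]
    rw [Finset.sum_comm]
    refine Finset.sum_eq_zero fun i _ => ?_
    have : ∀ r : Fin (N + 1), q r * (c i * (α i ^ (D - (j + r)) * β i ^ (j + (r : ℕ)))) =
        (c i * α i ^ (D - N - j) * β i ^ j) * (α i ^ (N - (r : ℕ)) * β i ^ (r : ℕ) * q r) := by
      intro r
      have hr := r.2
      have : D - (j + r) = (D - N - j) + (N - r) := by omega
      rw [this, pow_add, pow_add]
      ring
    rw [Finset.sum_congr rfl fun r _ => this r, ← Finset.mul_sum, hq' i, mul_zero]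
  -- the top nonzero entry of `q`
  obtain ⟨R, hR, hRmax⟩ : ∃ R : Fin (N + 1), q R ≠ 0 ∧ ∀ r, R < r → q r = 0 := by
    have hne : (Finset.univ.filter fun r => q r ≠ 0).Nonempty := by
      obtain ⟨r, hr⟩ := Function.ne_iff.1 hq0
      exact ⟨r, by simpa using hr⟩
    refine ⟨_, (Finset.mem_filter.1 (Finset.max'_mem _ hne)).2, fun r hr => ?_⟩
    by_contra h
    exact absurd (Finset.le_max' (Finset.univ.filter fun r => q r ≠ 0) r (by simpa using h))
      (not_le.2 hr)
  intro j
  induction j using Nat.strong_induction_on with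
  | _ m ih =>
    intro hm
    by_cases hw : m < N ∨ N + k ≤ m
    · exact h0 m hm hw
    · have hRN := R.2
      have h := hrel (m - R) (by omega)
      rw [Finset.sum_eq_single R] at h
      · have e : m - (R : ℕ) + R = m := by omega
        rw [e] at h
        exact (mul_eq_zero.1 h).resolve_left hR
      · intro r _ hne
        rcases lt_or_gt_of_ne hne with hlt | hgt
        · have hlt' : (r : ℕ) < R := hlt
          rw [ih (m - R + r) (by omega) (by omega), mul_zero]
        · rw [hRmax r hgt, zero_mul]
      · simp

/-- Let `K` be an algebraically closed field of characteristic `0`. For all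
integers `n ≥ 1` and `k ≥ 1` there exists a `k`-dimensional subspace `A` of `S_{2n+k−1}` such
that no nonzero element of `A` is a `K`-linear combination of at most `n` polynomials of the
form `ℓ^(2n+k−1)` with `ℓ` a linear form (i.e. `P(A)` misses the `n`-secant variety of the
rational normal curve of degree `2n+k−1`). -/
theorem statement14 (K : Type) [Field K] [CharZero K] [IsAlgClosed K]
    (n k : ℤ) (hn : 1 ≤ n) (hk : 1 ≤ k) :
    ∃ A : Submodule K ↥(S K (2*n+k-1)),
      Module.finrank K ↥A = k.toNat ∧
      ∀ p ∈ A,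
        (∃ (c : Fin n.toNat → K) (ℓ : Fin n.toNat → ↥(S K 1)),
          (p : MvPolynomial (Fin 2) K) =
            ∑ i, c i • ((ℓ i : MvPolynomial (Fin 2) K) ^ (2*n+k-1).toNat)) →
        p = 0 := by
  obtain ⟨N, rfl⟩ := Int.eq_ofNat_of_zero_le (by omega : 0 ≤ n)
  obtain ⟨k, rfl⟩ := Int.eq_ofNat_of_zero_le (by omega : 0 ≤ k)
  obtain ⟨D, hDD⟩ := Int.eq_ofNat_of_zero_le (by omega : 0 ≤ 2 * (N : ℤ) + k - 1)
  have hD : D + 1 = 2 * N + k := by omega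
  rw [hDD]
  simp only [Int.toNat_natCast]
  have hS : S K (D : ℤ) = homogeneousSubmodule (Fin 2) K D := by simp [S]
  have hS1 : S K 1 = homogeneousSubmodule (Fin 2) K 1 := by simp [S]
  have hmem : ∀ i : Fin k, monomial (expo D (N + i)) (1 : K) ∈ S K (D : ℤ) := by
    intro i
    have hi := i.2
    rw [hS, mem_homogeneousSubmodule]
    apply isHomogeneous_monomial
    simp [expo, Finsupp.degree_eq_sum]
    omega
  let v : Fin k → S K (D : ℤ) := fun i => ⟨_, hmem i⟩
  have hv : LinearIndependent K v := by
    apply LinearIndependent.of_comp (S K (D : ℤ)).subtype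
    have h1 := (basisMonomials (Fin 2) K).linearIndependent.comp
      (fun i : Fin k => expo D (N + i)) (fun i j h => by
        have := expo_inj h
        exact Fin.ext (by omega))
    have h2 : (⇑(S K (D : ℤ)).subtype ∘ v) =
        (⇑(basisMonomials (Fin 2) K) ∘ fun i : Fin k => expo D (N + i)) := by
      ext1 i
      simp [v]
    rw [h2]
    exact h1
  refine ⟨Submodule.span K (Set.range v), ?_, ?_⟩
  · rw [finrank_span_eq_card hv, Fintype.card_fin]
  · rintro p hp ⟨c, ℓ, hpe⟩
    have hz : ∀ j, (j < N ∨ N + k ≤ j) → coeff (expo D j) (p : MvPolynomial (Fin 2) K) = 0 := by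
      intro j hj
      have hle : Submodule.span K (Set.range v) ≤
          LinearMap.ker ((lcoeff K (expo D j)) ∘ₗ (S K (D : ℤ)).subtype) := by
        rw [Submodule.span_le]
        rintro _ ⟨i, rfl⟩
        have hi := i.2
        simp only [SetLike.mem_coe, LinearMap.mem_ker, LinearMap.comp_apply,
          Submodule.subtype_apply, lcoeff_apply, v, coeff_monomial]
        rw [if_neg]
        intro h
        have := expo_inj h
        omega
      simpa using hle hp
    have hℓ : ∀ i, (ℓ i : MvPolynomial (Fin 2) K) =
        C (coeff (expo 1 0) (ℓ i : MvPolynomial (Fin 2) K)) * X 0 +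
        C (coeff (expo 1 1) (ℓ i : MvPolynomial (Fin 2) K)) * X 1 := by
      intro i
      apply linear_form_eq
      exact (mem_homogeneousSubmodule _ _).1 (hS1.le (ℓ i).2)
    generalize hα : (fun i => coeff (expo 1 0) (ℓ i : MvPolynomial (Fin 2) K)) = α at *
    generalize hβ : (fun i => coeff (expo 1 1) (ℓ i : MvPolynomial (Fin 2) K)) = β at *
    have hℓ' : ∀ i, (ℓ i : MvPolynomial (Fin 2) K) = C (α i) * X 0 + C (β i) * X 1 := by
      intro i
      rw [← hα, ← hβ]
      exact hℓ i
    have hco : ∀ j, j ≤ D → coeff (expo D j) (p : MvPolynomial (Fin 2) K) =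
        (D.choose j : K) * ∑ i, c i * (α i ^ (D - j) * β i ^ j) := by
      intro j hj
      rw [hpe, coeff_sum, Finset.mul_sum]
      refine Finset.sum_congr rfl fun i _ => ?_
      rw [coeff_smul, hℓ', coeff_linear_pow _ _ _ _ hj, smul_eq_mul]
      ring
    have hall := hankel N k D hD c α β (fun j hj hw => by
      have h := hz j hw
      rw [hco j hj] at h
      refine (mul_eq_zero.1 h).resolve_left ?_
      exact_mod_cast (Nat.choose_pos hj).ne')
    have hph : (p : MvPolynomial (Fin 2) K).IsHomogeneous D := by
      exact (mem_homogeneousSubmodule _ _).1 (hS.le p.2)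
    apply Subtype.ext
    ext e
    by_cases he : e.degree = D
    · have h2 : e 0 + e 1 = D := by
        rw [← he, Finsupp.degree_eq_sum]; simp
      rw [expo_of_degree e he, hco _ (by omega), hall _ (by omega)]
      simp
    · rw [hph.coeff_eq_zero he]
      simp
end
end
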